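/- arXiv:2203.08469 — 5 statements merged into one kernel-verified Lean document; each statement's English description precedes it below -/
import Mathlib

section
/- Let X, Y be Banach spaces and T > 0, and suppose the family (U(t,s))_{0≤s≤t≤T}, the observation family (C(t))_{t∈[0,T]}, and the cutoff family (P_λ)_{λ>0} satisfy the abstract hypotheses (algebraic evolution-family property, exponential boundedness, boundedness and measurability for C, boundedness of (P_λ), the uncertainty principle and the dissipation estimate with exponents γ₁ < γ₂). Let E ⊆ [0,T] be measurable with positive Lebesgue measure and let r ∈ [1,∞). Then there exists a constant C_obs ≥ 0 such that for all x₀ ∈ X one has ‖U(T,0)x₀‖_X ≤ C_obs · (∫_E ‖C(t)(U(t,0)x₀)‖_Y^r dt)^{1/r}. -/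
open MeasureTheory Set

open Filter Topology

/-- Near the right of a density point of `E`, the set `E` fills at least half of the last quarter
of every short interval. -/
lemma exists_right_density_point {T : ℝ} {E : Set ℝ} (hE : MeasurableSet E)
    (hEsub : E ⊆ Icc 0 T) (hEpos : 0 < volume E) :
    ∃ l h : ℝ, 0 ≤ l ∧ 0 < h ∧ l + h ≤ T ∧
      ∀ δ : ℝ, 0 < δ → δ ≤ h → δ / 8 ≤ volume.real (E ∩ Ioc (l + 3 / 4 * δ) (l + δ)) := by
  have hae := Besicovitch.ae_tendsto_measure_inter_div (volume : Measure ℝ) E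
  have hne : ∀ᵐ x ∂(volume.restrict E), x ≠ T :=
    ae_restrict_of_ae (Measure.ae_ne volume T)
  have hmem : ∀ᵐ x ∂(volume.restrict E), x ∈ E := ae_restrict_mem hE
  have : NeBot (ae (volume.restrict E)) := by
    rw [ae_neBot]
    intro h0
    rw [Measure.restrict_eq_zero] at h0
    exact hEpos.ne' h0
  obtain ⟨l, hl, hlT, hlE⟩ := (hae.and (hne.and hmem)).exists
  have hl0 : 0 ≤ l := (hEsub hlE).1
  have hlT' : l < T := lt_of_le_of_ne (hEsub hlE).2 hlT
  have hev : ∀ᶠ δ in 𝓝[>] (0 : ℝ), ENNReal.ofReal (15 / 16) <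
      volume (E ∩ Metric.closedBall l δ) / volume (Metric.closedBall l δ) := by
    refine hl.eventually (lt_mem_nhds ?_)
    rw [← ENNReal.ofReal_one]
    exact (ENNReal.ofReal_lt_ofReal_iff one_pos).2 (by norm_num)
  obtain ⟨u, hu, hu'⟩ := (mem_nhdsGT_iff_exists_Ioc_subset).1 hev
  have hu0 : (0 : ℝ) < u := hu
  refine ⟨l, min u (T - l), hl0, lt_min hu0 (by linarith), ?_, ?_⟩
  · have := min_le_right u (T - l)
    linarith
  intro δ hδ hδh
  have h1 : ENNReal.ofReal (15 / 16) <
      volume (E ∩ Metric.closedBall l δ) / volume (Metric.closedBall l δ) :=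
    hu' ⟨hδ, hδh.trans (min_le_left _ _)⟩
  rw [Real.volume_closedBall] at h1
  have h2 := ENNReal.mul_lt_of_lt_div h1
  rw [← ENNReal.ofReal_mul (by norm_num)] at h2
  have hfin : volume (E ∩ Metric.closedBall l δ) ≠ ⊤ :=
    ne_top_of_le_ne_top (by rw [Real.volume_closedBall]; exact ENNReal.ofReal_ne_top)
      (measure_mono inter_subset_right)
  have h3 : 15 / 16 * (2 * δ) < volume.real (E ∩ Metric.closedBall l δ) :=
    (ENNReal.ofReal_lt_iff_lt_toReal (by positivity) hfin).1 h2
  have hsub : E ∩ Metric.closedBall l δ ⊆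
      Icc (l - δ) (l + 3 / 4 * δ) ∪ (E ∩ Ioc (l + 3 / 4 * δ) (l + δ)) := by
    rintro x ⟨hxE, hx⟩
    rw [Real.closedBall_eq_Icc] at hx
    rcases le_or_gt x (l + 3 / 4 * δ) with hx' | hx'
    · exact Or.inl ⟨hx.1, hx'⟩
    · exact Or.inr ⟨hxE, hx', hx.2⟩
  have hfin2 : volume (Icc (l - δ) (l + 3 / 4 * δ) ∪ (E ∩ Ioc (l + 3 / 4 * δ) (l + δ))) ≠ ⊤ := by
    refine measure_union_ne_top (by simp) ?_
    exact ne_top_of_le_ne_top (by simp) (measure_mono inter_subset_right)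
  have h4 := (measureReal_mono hsub hfin2).trans (measureReal_union_le _ _)
  rw [Real.volume_real_Icc_of_le (by linarith)] at h4
  linarith

lemma exists_pos_add_mul_rpow_le {γ₁ γ₂ c : ℝ} (hγ₁ : 0 < γ₁) (hγ : γ₁ < γ₂) (hc : 0 < c)
    (A B : ℝ) : ∃ μ : ℝ, 0 < μ ∧ A + B * μ ^ γ₁ ≤ c * μ ^ γ₂ := by
  have h1 : Tendsto (fun μ : ℝ => μ ^ γ₁ * (c * μ ^ (γ₂ - γ₁) + -B)) atTop atTop :=
    (tendsto_rpow_atTop hγ₁).atTop_mul_atTop₀ (tendsto_atTop_add_const_right _ _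
      ((tendsto_rpow_atTop (sub_pos.2 hγ)).const_mul_atTop hc))
  obtain ⟨μ, hμA, hμ⟩ := ((h1.eventually_ge_atTop A).and (eventually_gt_atTop 0)).exists
  refine ⟨μ, hμ, ?_⟩
  have h2 : μ ^ γ₂ = μ ^ γ₁ * μ ^ (γ₂ - γ₁) := by
    rw [← Real.rpow_add hμ]; ring_nf
  rw [h2]
  linarith

/-- Choice of the spectral parameters `lam` and of the weights `a` in the telescoping series. -/
lemma exists_telescoping_weights {γ₁ γ₂ γ₃ d₁ d₃ N h : ℝ} (hγ₁ : 0 < γ₁) (hγ : γ₁ < γ₂)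
    (hγ₃ : 0 < γ₃) (hd₁ : 0 < d₁) (hd₃ : 0 < d₃) (hN : 0 < N) (hh : 0 < h) :
    ∃ (a lam : ℕ → ℝ) (D : ℝ), 0 ≤ D ∧ (∀ m, 0 < a m) ∧ (∀ m, 0 < lam m) ∧
      Tendsto a atTop (𝓝 0) ∧
      (∀ m, a m * (N * Real.exp (d₁ * lam m ^ γ₁ - d₃ * lam m ^ γ₂ * (h / 2 ^ m / 4) ^ γ₃)) ≤
        a (m + 1)) ∧
      (∀ m, a m * (N * Real.exp (d₁ * lam m ^ γ₁)) ≤ D * (h / 2 ^ m / 8)) := by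
  have hγ' : 0 < γ₂ - γ₁ := sub_pos.2 hγ
  set ρ : ℝ := 2 ^ (γ₃ / (γ₂ - γ₁)) with hρ
  have hρ1 : 1 < ρ := Real.one_lt_rpow one_lt_two (by positivity)
  have hρ0 : 0 < ρ := one_pos.trans hρ1
  set x : ℝ := ρ ^ γ₁ with hx
  have hx1 : 1 < x := Real.one_lt_rpow hρ1 hγ₁
  have hx0 : 0 < x := one_pos.trans hx1
  have hργ : ρ ^ γ₂ = x * 2 ^ γ₃ := by
    have : γ₂ = γ₁ + (γ₂ - γ₁) := by ring
    rw [this, Real.rpow_add hρ0, ← hx, hρ, ← Real.rpow_mul two_pos.le, div_mul_cancel₀ _ hγ'.ne']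
  obtain ⟨μ, hμ, hμle⟩ := exists_pos_add_mul_rpow_le (c := d₃ * (h / 4) ^ γ₃) hγ₁ hγ
    (by positivity) (|Real.log N| + Real.log 2) (d₁ * x)
  set b : ℝ := Real.log 2 / (x - 1) with hb
  have hlog2 : 0 < Real.log 2 := Real.log_pos one_lt_two
  have hb0 : 0 < b := div_pos hlog2 (by linarith)
  have hbx : b * (x - 1) = Real.log 2 := div_mul_cancel₀ _ (by linarith)
  set β : ℝ := d₁ * μ ^ γ₁ + b with hβ
  have hμγ : 0 < μ ^ γ₁ := Real.rpow_pos_of_pos hμ _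
  have hβ0 : 0 < β := by positivity
  have hpow (γ : ℝ) (m : ℕ) : (μ * ρ ^ m) ^ γ = μ ^ γ * (ρ ^ γ) ^ m := by
    rw [Real.mul_rpow hμ.le (by positivity), ← Real.rpow_natCast_mul hρ0.le,
      ← Real.rpow_mul_natCast hρ0.le, mul_comm γ]
  have hxm (m : ℕ) : 1 ≤ x ^ m := one_le_pow₀ hx1.le
  refine ⟨fun m => Real.exp (-(β * x ^ m)), fun m => μ * ρ ^ m, N * (8 / h), by positivity,
    fun m => Real.exp_pos _, fun m => by positivity, ?_, ?_, ?_⟩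
  · exact Real.tendsto_exp_neg_atTop_nhds_zero.comp
      ((tendsto_pow_atTop_atTop_of_one_lt hx1).const_mul_atTop hβ0)
  · intro m
    have h1 : (h / 2 ^ m / 4) ^ γ₃ = (h / 4) ^ γ₃ / (2 ^ γ₃) ^ m := by
      rw [div_right_comm, Real.div_rpow (by positivity) (by positivity),
        ← Real.rpow_natCast_mul two_pos.le, ← Real.rpow_mul_natCast two_pos.le, mul_comm γ₃]
    have h2 : d₃ * (μ ^ γ₂ * (x * 2 ^ γ₃) ^ m) * ((h / 4) ^ γ₃ / (2 ^ γ₃) ^ m) =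
        d₃ * (h / 4) ^ γ₃ * μ ^ γ₂ * x ^ m := by
      have : (0 : ℝ) < 2 ^ γ₃ := by positivity
      rw [mul_pow]
      field_simp
    simp only [hpow, hργ, ← hx]
    rw [h1, h2]
    nth_rewrite 1 [← Real.exp_log hN]
    rw [← Real.exp_add, ← Real.exp_add, Real.exp_le_exp, pow_succ]
    have h3 := mul_le_mul_of_nonneg_right hμle (zero_le_one.trans (hxm m))
    have h4 : Real.log N ≤ |Real.log N| * x ^ m :=
      (le_abs_self _).trans (le_mul_of_one_le_right (abs_nonneg _) (hxm m))
    have h5 : β * (x ^ m * x) - β * x ^ m = (d₁ * μ ^ γ₁ * (x - 1) + Real.log 2) * x ^ m := by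
      rw [← hbx, hβ]; ring
    linarith
  · intro m
    have hbern : 1 + (m : ℝ) * (x - 1) ≤ x ^ m := by
      have := one_add_mul_le_pow (a := x - 1) (by linarith) m
      simpa using this
    have h1 : Real.exp (-(b * x ^ m)) ≤ 1 / 2 ^ m := by
      rw [one_div, ← Real.exp_log (show (0 : ℝ) < (2 ^ m)⁻¹ by positivity), Real.exp_le_exp,
        Real.log_inv, Real.log_pow, ← hbx]
      nlinarith
    have h2 : Real.exp (-(β * x ^ m)) * (N * Real.exp (d₁ * (μ * ρ ^ m) ^ γ₁)) =
        N * Real.exp (-(b * x ^ m)) := by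
      rw [hpow, ← hx, mul_left_comm, ← Real.exp_add, hβ]
      ring_nf
    rw [h2]
    calc N * Real.exp (-(b * x ^ m)) ≤ N * (1 / 2 ^ m) := by gcongr
      _ = N * (8 / h) * (h / 2 ^ m / 8) := by field_simp

lemma mul_le_integral_of_forall_le {S : Set ℝ} (hS : MeasurableSet S) (hSfin : volume S ≠ ⊤)
    {G : ℝ → ℝ} (hG : ∀ t, 0 ≤ G t) (hGint : IntegrableOn G S) {A α b κ : ℝ} (hα : 0 ≤ α)
    (hκ : 0 ≤ κ) (hκS : κ ≤ volume.real S) (h : ∀ t ∈ S, A ≤ α * G t + b) :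
    (A - b) * κ ≤ α * ∫ t in S, G t := by
  have h0 : 0 ≤ ∫ t in S, G t := integral_nonneg fun t => hG t
  rcases le_or_gt (A - b) 0 with hA | hA
  · exact (mul_nonpos_of_nonpos_of_nonneg hA hκ).trans (mul_nonneg hα h0)
  calc (A - b) * κ ≤ (A - b) * volume.real S := by gcongr
    _ = ∫ _ in S, (A - b) := by rw [setIntegral_const, smul_eq_mul, mul_comm]
    _ ≤ ∫ t in S, α * G t :=
        setIntegral_mono_on (integrableOn_const hSfin) (hGint.const_mul α) hS
          fun t ht => by linarith [h t ht]
    _ = α * ∫ t in S, G t := integral_const_mul _ _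

/-- The Lebeau–Robbiano telescoping argument, with a constant that does not depend on `F`, `G`. -/
lemma exists_observability_of_interpolation {γ₁ γ₂ γ₃ d₁ d₃ N T : ℝ} (hγ₁ : 0 < γ₁) (hγ : γ₁ < γ₂)
    (hγ₃ : 0 < γ₃) (hd₁ : 0 < d₁) (hd₃ : 0 < d₃) (hN : 0 < N) {E : Set ℝ} (hE : MeasurableSet E)
    (hEsub : E ⊆ Icc 0 T) (hEpos : 0 < volume E) :
    ∃ c : ℝ, 0 ≤ c ∧ ∀ F G : ℝ → ℝ, (∀ t, 0 ≤ F t) → (∀ t, 0 ≤ G t) → IntegrableOn G E →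
      (∀ s t : ℝ, 0 ≤ s → s ≤ t → t ≤ T → F t ≤ N * F s) →
      (∀ lam : ℝ, 0 < lam → ∀ s t : ℝ, 0 ≤ s → s ≤ t → t ≤ T →
        F t ≤ N * Real.exp (d₁ * lam ^ γ₁) * G t +
          N * Real.exp (d₁ * lam ^ γ₁ - d₃ * lam ^ γ₂ * (t - s) ^ γ₃) * F s) →
      F T ≤ c * ∫ t in E, G t := by
  obtain ⟨l, h, hl, hh, hlh, hdens⟩ := exists_right_density_point hE hEsub hEpos
  obtain ⟨a, lam, D, hD, ha, hlam, ha0, hstep, hcost⟩ :=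
    exists_telescoping_weights (N := N * N) (h := h) hγ₁ hγ hγ₃ hd₁ hd₃ (by positivity) hh
  refine ⟨N * (D / a 0), by have := ha 0; positivity, ?_⟩
  intro F G hF hG hGint hmono hinterp
  set τ : ℕ → ℝ := fun m => l + h / 2 ^ m with hτ
  have hδ (m : ℕ) : 0 < h / 2 ^ m := by positivity
  have hδh (m : ℕ) : h / 2 ^ m ≤ h := div_le_self hh.le (one_le_pow₀ one_le_two)
  have hτ_succ (m : ℕ) : τ (m + 1) = l + h / 2 ^ m / 2 := by
    simp only [hτ, pow_succ, div_div]
  have hτ_anti (m : ℕ) : τ (m + 1) ≤ τ m := by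
    rw [hτ_succ]; simp only [hτ]; linarith [hδ m]
  have hτ_le (m : ℕ) : τ m ≤ τ 0 := antitone_nat_of_succ_le hτ_anti (Nat.zero_le m)
  have hτ0 : τ 0 ≤ T := by simpa [hτ] using hlh
  have hτ_nonneg (m : ℕ) : 0 ≤ τ m := add_nonneg hl (hδ m).le
  have hone_step (m : ℕ) : a m * F (τ m) ≤
      D * (∫ t in E ∩ Ioc (τ (m + 1)) (τ m), G t) + a (m + 1) * F (τ (m + 1)) := by
    set δ := h / 2 ^ m with hδ_def
    have hδ0 : 0 < δ := hδ m
    set S := E ∩ Ioc (l + 3 / 4 * δ) (l + δ) with hS_def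
    have hS : MeasurableSet S := hE.inter measurableSet_Ioc
    have hSfin : volume S ≠ ⊤ :=
      ne_top_of_le_ne_top (by simp) (measure_mono inter_subset_right)
    have hSsub : S ⊆ E ∩ Ioc (τ (m + 1)) (τ m) := by
      refine inter_subset_inter_right _ (Ioc_subset_Ioc_left ?_)
      rw [hτ_succ]; linarith
    have hpt : ∀ t ∈ S, F (τ m) ≤ N * N * Real.exp (d₁ * lam m ^ γ₁) * G t +
        N * N * Real.exp (d₁ * lam m ^ γ₁ - d₃ * lam m ^ γ₂ * (δ / 4) ^ γ₃) * F (τ (m + 1)) := by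
      rintro t ⟨-, ht1, ht2⟩
      have hst : τ (m + 1) + δ / 4 ≤ t := by rw [hτ_succ]; linarith
      have htT : t ≤ T := ht2.trans ((hτ_le m).trans hτ0)
      have ht0 : 0 ≤ t := by linarith [hτ_nonneg (m + 1)]
      have hi := hinterp (lam m) (hlam m) (τ (m + 1)) t (hτ_nonneg _) (by linarith) htT
      have hlamγ : 0 ≤ lam m ^ γ₂ := (Real.rpow_pos_of_pos (hlam m) _).le
      have hexp : Real.exp (d₁ * lam m ^ γ₁ - d₃ * lam m ^ γ₂ * (t - τ (m + 1)) ^ γ₃) ≤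
          Real.exp (d₁ * lam m ^ γ₁ - d₃ * lam m ^ γ₂ * (δ / 4) ^ γ₃) := by
        gcongr
        linarith
      calc F (τ m) ≤ N * F t := hmono t (τ m) ht0 ht2 ((hτ_le m).trans hτ0)
        _ ≤ N * (N * Real.exp (d₁ * lam m ^ γ₁) * G t +
            N * Real.exp (d₁ * lam m ^ γ₁ - d₃ * lam m ^ γ₂ * (δ / 4) ^ γ₃) * F (τ (m + 1))) := by
          have := hF (τ (m + 1))
          refine mul_le_mul_of_nonneg_left (hi.trans ?_) hN.le
          gcongr
        _ = _ := by ring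
    have havg := mul_le_integral_of_forall_le hS hSfin hG (hGint.mono_set inter_subset_left)
      (by positivity) (by positivity) (hdens δ hδ0 (hδh m)) hpt
    have hIle : ∫ t in S, G t ≤ ∫ t in E ∩ Ioc (τ (m + 1)) (τ m), G t :=
      setIntegral_mono_set (hGint.mono_set inter_subset_left) (ae_of_all _ hG)
        hSsub.eventuallyLE
    have hI0 : 0 ≤ ∫ t in S, G t := integral_nonneg fun t => hG t
    have h1 : a m * (F (τ m) -
        N * N * Real.exp (d₁ * lam m ^ γ₁ - d₃ * lam m ^ γ₂ * (δ / 4) ^ γ₃) * F (τ (m + 1))) ≤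
        D * ∫ t in S, G t := by
      refine le_of_mul_le_mul_right ?_ (show 0 < δ / 8 by positivity)
      have h2 := mul_le_mul_of_nonneg_left havg (ha m).le
      have h3 := mul_le_mul_of_nonneg_right (hcost m) hI0
      linarith
    have h4 := mul_le_mul_of_nonneg_right (hstep m) (hF (τ (m + 1)))
    have h5 := mul_le_mul_of_nonneg_left hIle hD
    linarith
  have hsum (n : ℕ) : a 0 * F (τ 0) ≤
      D * (∫ t in E ∩ Ioc (τ n) (τ 0), G t) + a n * F (τ n) := by
    induction n with
    | zero => simp
    | succ n ih =>
      have hunion : E ∩ Ioc (τ (n + 1)) (τ 0) =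
          E ∩ Ioc (τ (n + 1)) (τ n) ∪ E ∩ Ioc (τ n) (τ 0) := by
        rw [← inter_union_distrib_left, Ioc_union_Ioc_eq_Ioc (hτ_anti n) (hτ_le n)]
      have hdisj : Disjoint (E ∩ Ioc (τ (n + 1)) (τ n)) (E ∩ Ioc (τ n) (τ 0)) :=
        ((Ioc_disjoint_Ioc_of_le le_rfl).mono inter_subset_right inter_subset_right)
      rw [hunion, setIntegral_union hdisj (hE.inter measurableSet_Ioc)
        (hGint.mono_set inter_subset_left) (hGint.mono_set inter_subset_left)]
      linarith [hone_step n]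
  have hbound (n : ℕ) : a 0 * F (τ 0) ≤ D * (∫ t in E, G t) + a n * (N * F 0) := by
    have h1 : ∫ t in E ∩ Ioc (τ n) (τ 0), G t ≤ ∫ t in E, G t :=
      setIntegral_mono_set hGint (ae_of_all _ hG) inter_subset_left.eventuallyLE
    have h2 := mul_le_mul_of_nonneg_left h1 hD
    have h3 := mul_le_mul_of_nonneg_left
      (hmono 0 (τ n) le_rfl (hτ_nonneg n) ((hτ_le n).trans hτ0)) (ha n).le
    linarith [hsum n]
  have hlim : a 0 * F (τ 0) ≤ D * ∫ t in E, G t := by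
    have hlim0 := (ha0.mul_const (N * F 0)).const_add (D * ∫ t in E, G t)
    rw [zero_mul, add_zero] at hlim0
    exact ge_of_tendsto' hlim0 hbound
  calc F T ≤ N * F (τ 0) := hmono _ _ (hτ_nonneg 0) hτ0 le_rfl
    _ ≤ N * (D / a 0 * ∫ t in E, G t) := by
      gcongr
      rw [div_mul_eq_mul_div, le_div_iff₀ (ha 0)]
      linarith
    _ = _ := by ring

lemma setIntegral_le_mul_rpow_setIntegral_rpow {E : Set ℝ} (hEfin : volume E ≠ ⊤) {r : ℝ}
    (hr : 1 ≤ r) {G : ℝ → ℝ} (hG : ∀ t, 0 ≤ G t) {B : ℝ} (hGB : ∀ t ∈ E, G t ≤ B)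
    (hE : MeasurableSet E) (hGmeas : AEStronglyMeasurable G (volume.restrict E)) :
    ∫ t in E, G t ≤ volume.real E ^ (1 - 1 / r) * (∫ t in E, G t ^ r) ^ (1 / r) := by
  rcases hr.eq_or_lt with rfl | hr'
  · simp
  have : IsFiniteMeasure (volume.restrict E) := isFiniteMeasure_restrict.2 hEfin
  have hpq : r.HolderConjugate r.conjExponent := Real.HolderConjugate.conjExponent hr'
  have hGLp : MemLp G (ENNReal.ofReal r) (volume.restrict E) := by
    refine MemLp.of_bound hGmeas B ?_
    filter_upwards [ae_restrict_mem hE] with t ht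
    rw [Real.norm_of_nonneg (hG t)]
    exact hGB t ht
  have h1 := integral_mul_le_Lp_mul_Lq_of_nonneg (μ := volume.restrict E) hpq
    (f := G) (g := fun _ => 1) (ae_of_all _ hG) (ae_of_all _ fun _ => zero_le_one) hGLp
    (memLp_const 1)
  have h2 : 1 - 1 / r = 1 / r.conjExponent := by
    rw [one_div, one_div, hpq.one_sub_inv]
  rw [h2]
  simpa [mul_comm] using h1

/-- **Final-state observability in `L^r(E;Y)`, `r ∈ [1,∞)`.** Under the abstract hypotheses
(evolution family property, exponential boundedness, bounded measurable observations,
bounded cutoffs, uncertainty principle and dissipation estimate with `γ₁ < γ₂`), for every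
measurable `E ⊆ [0,T]` of positive measure and every `r ∈ [1,∞)` there is `C_obs ≥ 0` with
`‖U(T,0)x₀‖ ≤ C_obs (∫_E ‖C(t)U(t,0)x₀‖^r dt)^{1/r}` for all `x₀`. -/
theorem statement0
    {X Y : Type*} [NormedAddCommGroup X] [NormedSpace ℝ X] [CompleteSpace X]
    [NormedAddCommGroup Y] [NormedSpace ℝ Y] [CompleteSpace Y]
    (T : ℝ) (hT : 0 < T)
    (U : ℝ → ℝ → X →L[ℝ] X)
    (hUid : ∀ s ∈ Icc (0 : ℝ) T, U s s = ContinuousLinearMap.id ℝ X)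
    (hUcomp : ∀ r s t : ℝ, 0 ≤ r → r ≤ s → s ≤ t → t ≤ T →
      (U t s).comp (U s r) = U t r)
    (M ω : ℝ) (hM : 1 ≤ M)
    (hUexp : ∀ s t : ℝ, 0 ≤ s → s ≤ t → t ≤ T → ‖U t s‖ ≤ M * Real.exp (ω * (t - s)))
    (C : ℝ → X →L[ℝ] Y) (K : ℝ) (hC : ∀ t ∈ Icc (0 : ℝ) T, ‖C t‖ ≤ K)
    (hCmeas : ∀ x₀ : X, Measurable fun t : Icc (0 : ℝ) T => ‖C t.1 ((U t.1 0) x₀)‖)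
    (P : ℝ → X →L[ℝ] X) (KP : ℝ) (hP : ∀ lam : ℝ, 0 < lam → ‖P lam‖ ≤ KP)
    (d₀ d₁ γ₁ : ℝ) (hd₀ : 0 < d₀) (hd₁ : 0 < d₁) (hγ₁ : 0 < γ₁)
    (huncert : ∀ lam : ℝ, 0 < lam → ∀ t ∈ Icc (0 : ℝ) T, ∀ x : X,
      ‖P lam x‖ ≤ d₀ * Real.exp (d₁ * lam ^ γ₁) * ‖C t (P lam x)‖)
    (d₂ d₃ γ₂ γ₃ : ℝ) (hd₂ : 1 ≤ d₂) (hd₃ : 0 < d₃) (hγ₂ : 0 < γ₂) (hγ₃ : 0 < γ₃)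
    (hγ : γ₁ < γ₂)
    (hdiss : ∀ lam : ℝ, 0 < lam → ∀ s t : ℝ, 0 ≤ s → s ≤ t → t ≤ T → ∀ x : X,
      ‖U t s x - P lam (U t s x)‖ ≤
        d₂ * Real.exp (-(d₃ * lam ^ γ₂ * (t - s) ^ γ₃)) * ‖x‖)
    (E : Set ℝ) (hEmeas : MeasurableSet E) (hEsub : E ⊆ Icc 0 T) (hEpos : 0 < volume E)
    (r : ℝ) (hr : 1 ≤ r) :
    ∃ Cobs : ℝ, 0 ≤ Cobs ∧ ∀ x₀ : X,
      ‖U T 0 x₀‖ ≤ Cobs * (∫ t in E, ‖C t (U t 0 x₀)‖ ^ r) ^ (1 / r) := by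
  have h0T : (0 : ℝ) ∈ Icc (0 : ℝ) T := ⟨le_rfl, hT.le⟩
  have hK : 0 ≤ K := (norm_nonneg _).trans (hC 0 h0T)
  set M' : ℝ := M * Real.exp (|ω| * T) with hM'
  have hUbound (s t : ℝ) (hs : 0 ≤ s) (hst : s ≤ t) (ht : t ≤ T) : ‖U t s‖ ≤ M' := by
    refine (hUexp s t hs hst ht).trans ?_
    have : ω * (t - s) ≤ |ω| * T :=
      mul_le_mul (le_abs_self ω) (by linarith) (by linarith) (abs_nonneg ω)
    rw [hM']
    gcongr
  have hM'0 : 0 < M' := by positivity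
  set N : ℝ := M' + d₀ + (d₀ * K + 1) * d₂ with hN
  have hd₂0 : 0 < d₂ := by linarith
  have hKd : 0 ≤ d₀ * K * d₂ := by positivity
  have hN0 : 0 < N := by positivity
  have hNM : M' ≤ N := by linarith
  have hNd : d₀ ≤ N := by linarith
  have hNd₂ : (d₀ * K + 1) * d₂ ≤ N := by linarith
  obtain ⟨c, hc, hobs⟩ := exists_observability_of_interpolation (N := N) hγ₁ hγ hγ₃ hd₁ hd₃ hN0
    hEmeas hEsub hEpos
  have hEfin : volume E ≠ ⊤ := ne_top_of_le_ne_top (by simp) (measure_mono hEsub)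
  refine ⟨c * volume.real E ^ (1 - 1 / r), by positivity, fun x₀ => ?_⟩
  have hcocycle (s t : ℝ) (hs : 0 ≤ s) (hst : s ≤ t) (ht : t ≤ T) :
      U t s (U s 0 x₀) = U t 0 x₀ := by
    rw [← hUcomp 0 s t le_rfl hs hst ht, ContinuousLinearMap.comp_apply]
  have hGB : ∀ t ∈ E, ‖C t (U t 0 x₀)‖ ≤ K * (M' * ‖x₀‖) := by
    intro t ht
    have htT := hEsub ht
    refine (C t).le_of_opNorm_le_of_le (hC t htT) ?_
    exact (U t 0).le_of_opNorm_le (hUbound 0 t le_rfl htT.1 htT.2) x₀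
  have hGmeas : AEStronglyMeasurable (fun t => ‖C t (U t 0 x₀)‖) (volume.restrict E) := by
    have h1 : AEMeasurable (fun t => ‖C t (U t 0 x₀)‖) (volume.restrict (Icc 0 T)) :=
      (aemeasurable_restrict_iff_comap_subtype measurableSet_Icc).2 (hCmeas x₀).aemeasurable
    exact (h1.mono_measure (Measure.restrict_mono hEsub le_rfl)).aestronglyMeasurable
  have hGint : IntegrableOn (fun t => ‖C t (U t 0 x₀)‖) E := by
    refine IntegrableOn.of_bound hEfin.lt_top hGmeas (K * (M' * ‖x₀‖)) ?_
    filter_upwards [ae_restrict_mem hEmeas] with t ht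
    rw [norm_norm]
    exact hGB t ht
  have hF := hobs (fun t => ‖U t 0 x₀‖) (fun t => ‖C t (U t 0 x₀)‖) (fun _ => norm_nonneg _)
    (fun _ => norm_nonneg _) hGint ?_ ?_
  · have hH := setIntegral_le_mul_rpow_setIntegral_rpow hEfin hr (fun _ => norm_nonneg _) hGB
      hEmeas hGmeas
    calc ‖U T 0 x₀‖ ≤ c * ∫ t in E, ‖C t (U t 0 x₀)‖ := hF
      _ ≤ c * (volume.real E ^ (1 - 1 / r) *
          (∫ t in E, ‖C t (U t 0 x₀)‖ ^ r) ^ (1 / r)) := by gcongr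
      _ = _ := by ring
  · intro s t hs hst ht
    rw [← hcocycle s t hs hst ht]
    exact (U t s).le_of_opNorm_le ((hUbound s t hs hst ht).trans hNM) _
  · intro lam hlam s t hs hst ht
    have htT : t ∈ Icc (0 : ℝ) T := ⟨hs.trans hst, ht⟩
    have hdis := hdiss lam hlam s t hs hst ht (U s 0 x₀)
    rw [hcocycle s t hs hst ht] at hdis
    set u := U t 0 x₀
    set v := U s 0 x₀
    set e₁ := Real.exp (d₁ * lam ^ γ₁) with he₁
    have he₁1 : 1 ≤ e₁ :=
      Real.one_le_exp (mul_nonneg hd₁.le (Real.rpow_nonneg hlam.le _))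
    set e₂ := Real.exp (-(d₃ * lam ^ γ₂ * (t - s) ^ γ₃)) with he₂
    have hexp : Real.exp (d₁ * lam ^ γ₁ - d₃ * lam ^ γ₂ * (t - s) ^ γ₃) = e₁ * e₂ := by
      rw [he₁, he₂, ← Real.exp_add, sub_eq_add_neg]
    rw [hexp]
    have h1 : ‖u‖ ≤ ‖P lam u‖ + ‖u - P lam u‖ := norm_le_norm_add_norm_sub' _ _
    have h2 : ‖C t (P lam u)‖ ≤ ‖C t u‖ + K * ‖u - P lam u‖ := by
      have h3 : ‖C t (u - P lam u)‖ ≤ K * ‖u - P lam u‖ :=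
        (C t).le_of_opNorm_le (hC t htT) _
      have h4 : C t (P lam u) = C t u - C t (u - P lam u) := by simp
      rw [h4]
      exact (norm_sub_le _ _).trans (by gcongr)
    calc ‖u‖ ≤ d₀ * e₁ * (‖C t u‖ + K * ‖u - P lam u‖) + e₁ * ‖u - P lam u‖ := by
          refine h1.trans (add_le_add ((huncert lam hlam t htT u).trans ?_) ?_)
          · gcongr
          · exact le_mul_of_one_le_left (norm_nonneg _) he₁1
      _ = d₀ * e₁ * ‖C t u‖ + (d₀ * K + 1) * e₁ * ‖u - P lam u‖ := by ring
      _ ≤ d₀ * e₁ * ‖C t u‖ + (d₀ * K + 1) * e₁ * (d₂ * e₂ * ‖v‖) := by gcongr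
      _ = d₀ * e₁ * ‖C t u‖ + (d₀ * K + 1) * d₂ * (e₁ * e₂) * ‖v‖ := by ring
      _ ≤ N * e₁ * ‖C t u‖ + N * (e₁ * e₂) * ‖v‖ := by gcongr
end

section
/- Let X, Y be Banach spaces and T > 0, and suppose the family (U(t,s))_{0≤s≤t≤T}, the observation family (C(t))_{t∈[0,T]}, and the cutoff family (P_λ)_{λ>0} satisfy the abstract hypotheses (algebraic evolution-family property, exponential boundedness, boundedness and measurability for C, boundedness of (P_λ), the uncertainty principle and the dissipation estimate with exponents γ₁ < γ₂). Let E ⊆ [0,T] be measurable with positive Lebesgue measure. Then there exists a constant C_obs ≥ 0 such that for all x₀ ∈ X one has ‖U(T,0)x₀‖_X ≤ C_obs · esssup_{t∈E} ‖C(t)(U(t,0)x₀)‖_Y. -/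
open MeasureTheory Set

/-- Near a density point `τ` of `E`, the set `E` charges every interval `[τ + 3r/4, τ + r]`. -/
theorem exists_density_point_right {E : Set ℝ} (hE : MeasurableSet E) (hpos : 0 < volume E) :
    ∃ τ ∈ E, ∃ r₀ : ℝ, 0 < r₀ ∧ ∀ r : ℝ, 0 < r → r ≤ r₀ →
      0 < volume (E ∩ Icc (τ + 3 / 4 * r) (τ + r)) := by
  have hae := Besicovitch.ae_tendsto_measure_inter_div (volume : Measure ℝ) E
  have hne : (ae (volume.restrict E)).NeBot := by
    rw [ae_neBot, Ne, Measure.restrict_eq_zero]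
    exact hpos.ne'
  obtain ⟨τ, hτ, hτE⟩ := (hae.and (ae_restrict_mem hE)).exists
  have hev := hτ.eventually_const_lt
    (show ENNReal.ofReal (7 / 8) < 1 from ENNReal.ofReal_lt_one.2 (by norm_num))
  obtain ⟨r₁, hr₁, hsub⟩ := mem_nhdsGT_iff_exists_Ioc_subset.1 hev
  refine ⟨τ, hτE, r₁, hr₁, fun r hr hrle => ?_⟩
  have hr' : ENNReal.ofReal (7 / 8)
      < volume (E ∩ Metric.closedBall τ r) / volume (Metric.closedBall τ r) :=
    hsub ⟨hr, hrle⟩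
  rw [Real.volume_closedBall] at hr'
  by_contra hzero
  have hzero' : volume (E ∩ Icc (τ + 3 / 4 * r) (τ + r)) = 0 := by simpa using hzero
  have hcover : E ∩ Metric.closedBall τ r
      ⊆ Icc (τ - r) (τ + 3 / 4 * r) ∪ (E ∩ Icc (τ + 3 / 4 * r) (τ + r)) := by
    rintro y ⟨hyE, hy⟩
    rw [Real.closedBall_eq_Icc] at hy
    rcases le_total y (τ + 3 / 4 * r) with h | h
    · exact Or.inl ⟨hy.1, h⟩
    · exact Or.inr ⟨hyE, h, hy.2⟩
  have hle : volume (E ∩ Metric.closedBall τ r) ≤ ENNReal.ofReal (7 / 4 * r) := by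
    refine (measure_mono hcover).trans ((measure_union_le _ _).trans ?_)
    rw [hzero', Real.volume_Icc, add_zero]
    exact ENNReal.ofReal_le_ofReal (by linarith)
  refine absurd hr' (not_lt.2 ?_)
  refine ENNReal.div_le_of_le_mul (hle.trans ?_)
  rw [← ENNReal.ofReal_mul (by norm_num)]
  exact ENNReal.ofReal_le_ofReal (by linarith)

/-- A bounded sequence with `G m ≤ S + G (m + 1) / 2` satisfies `G 0 ≤ 2 * S`. -/
theorem le_two_mul_of_le_add_half_succ {G : ℕ → ℝ} {S D : ℝ} (hD : ∀ m, G m ≤ D)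
    (hG : ∀ m, G m ≤ S + G (m + 1) / 2) : G 0 ≤ 2 * S := by
  have hiter : ∀ m : ℕ, G 0 - 2 * S ≤ (1 / 2 : ℝ) ^ m * (G m - 2 * S) := by
    intro m
    induction m with
    | zero => simp
    | succ k ih =>
      refine ih.trans ?_
      rw [pow_succ, mul_assoc]
      gcongr
      linarith [hG k]
  have hlim : Filter.Tendsto (fun m : ℕ => (1 / 2 : ℝ) ^ m * (D - 2 * S)) Filter.atTop
      (nhds (0 * (D - 2 * S))) :=
    (tendsto_pow_atTop_nhds_zero_of_lt_one (by norm_num) (by norm_num)).mul_const _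
  have hle : G 0 - 2 * S ≤ 0 * (D - 2 * S) := by
    refine ge_of_tendsto' hlim fun m => (hiter m).trans ?_
    gcongr
    exact hD m
  linarith

/-- Along dyadic time steps the frequencies can be chosen so that dissipation at frequency
`lam m` beats the spectral cost at frequency `lam (m + 1)`. -/
theorem exists_frequencies {N d c ρ γ₁ γ₂ γ₃ : ℝ} (hN : 0 < N) (hc : 0 < c)
    (hρ : 0 < ρ) (hγ₁ : 0 < γ₁) (hγ₃ : 0 < γ₃) (hγ : γ₁ < γ₂) :
    ∃ lam : ℕ → ℝ, (∀ m, 0 < lam m) ∧ ∀ m : ℕ,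
      N * Real.exp (-(c * lam m ^ γ₂ * (ρ * (1 / 2) ^ m) ^ γ₃)) * Real.exp (d * lam (m + 1) ^ γ₁)
        ≤ 1 / 2 := by
  have hγ' : 0 < γ₂ - γ₁ := sub_pos.2 hγ
  set κ := γ₃ / (γ₂ - γ₁) with hκ
  have hκ0 : 0 < κ := div_pos hγ₃ hγ'
  have hκγ : κ * γ₂ = κ * γ₁ + γ₃ := by
    rw [hκ]; field_simp; ring
  have hc' : 0 < c * ρ ^ γ₃ := by positivity
  obtain ⟨A, hA1, hA⟩ := ((Filter.eventually_ge_atTop (1 : ℝ)).and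
    ((tendsto_rpow_atTop hγ').eventually_ge_atTop
      ((d * 2 ^ (κ * γ₁) + |Real.log (2 * N)|) / (c * ρ ^ γ₃)))).exists
  have hA0 : 0 < A := by linarith
  rw [div_le_iff₀ hc'] at hA
  refine ⟨fun m => A * 2 ^ ((m : ℝ) * κ), fun m => by positivity, fun m => ?_⟩
  have h2 : (0 : ℝ) ≤ 2 := by norm_num
  have hlam : (A * (2 : ℝ) ^ ((m : ℝ) * κ)) ^ γ₂ * (ρ * (1 / 2) ^ m) ^ γ₃
      = A ^ γ₁ * A ^ (γ₂ - γ₁) * ρ ^ γ₃ * 2 ^ ((m : ℝ) * κ * γ₁) := by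
    have hhalf : ((1 / 2 : ℝ)) ^ m = 2 ^ (-(m : ℝ)) := by
      rw [Real.rpow_neg h2, Real.rpow_natCast, one_div, inv_pow]
    rw [hhalf, Real.mul_rpow hA0.le (by positivity), Real.mul_rpow hρ.le (by positivity),
      ← Real.rpow_mul h2, ← Real.rpow_mul h2, ← Real.rpow_add hA0, add_sub_cancel]
    have : (2 : ℝ) ^ ((m : ℝ) * κ * γ₁) = 2 ^ ((m : ℝ) * κ * γ₂) * 2 ^ (-(m : ℝ) * γ₃) := by
      rw [← Real.rpow_add two_pos]
      congr 1
      linear_combination (-(m : ℝ)) * hκγ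
    rw [this]; ring
  have hlam' : (A * (2 : ℝ) ^ (((m + 1 : ℕ) : ℝ) * κ)) ^ γ₁
      = A ^ γ₁ * 2 ^ (κ * γ₁) * 2 ^ ((m : ℝ) * κ * γ₁) := by
    rw [Real.mul_rpow hA0.le (by positivity), ← Real.rpow_mul h2, mul_assoc (A ^ γ₁),
      ← Real.rpow_add two_pos]
    congr 2
    push_cast; ring
  have hAγ : 1 ≤ A ^ γ₁ := Real.one_le_rpow hA1 hγ₁.le
  have hpow : (1 : ℝ) ≤ 2 ^ ((m : ℝ) * κ * γ₁) :=
    Real.one_le_rpow (by norm_num) (by positivity)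
  have hkey : Real.log (2 * N) ≤ c * ((A * (2 : ℝ) ^ ((m : ℝ) * κ)) ^ γ₂ *
      (ρ * (1 / 2) ^ m) ^ γ₃) - d * (A * (2 : ℝ) ^ (((m + 1 : ℕ) : ℝ) * κ)) ^ γ₁ := by
    rw [hlam, hlam']
    calc Real.log (2 * N) ≤ 1 * |Real.log (2 * N)| := by rw [one_mul]; exact le_abs_self _
      _ ≤ (A ^ γ₁ * 2 ^ ((m : ℝ) * κ * γ₁)) *
          (A ^ (γ₂ - γ₁) * (c * ρ ^ γ₃) - d * 2 ^ (κ * γ₁)) := by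
        refine mul_le_mul (one_le_mul_of_one_le_of_one_le hAγ hpow) (by linarith)
          (abs_nonneg _) (by positivity)
      _ = _ := by ring
  rw [mul_assoc, ← Real.exp_add]
  calc N * Real.exp _ ≤ N * Real.exp (-Real.log (2 * N)) := by
        gcongr
        rw [mul_assoc]
        linarith
    _ = 1 / 2 := by
        rw [Real.exp_neg, Real.exp_log (by positivity)]
        field_simp

/-- **Final-state observability in `L^∞(E;Y)`.** Under the abstract hypotheses
(evolution family property, exponential boundedness, bounded measurable observations,
bounded cutoffs, uncertainty principle and dissipation estimate with `γ₁ < γ₂`), for every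
measurable `E ⊆ [0,T]` of positive measure there is `C_obs ≥ 0` with
`‖U(T,0)x₀‖ ≤ C_obs · esssup_{t∈E} ‖C(t)U(t,0)x₀‖` for all `x₀`. -/
theorem statement1
    {X Y : Type*} [NormedAddCommGroup X] [NormedSpace ℝ X] [CompleteSpace X]
    [NormedAddCommGroup Y] [NormedSpace ℝ Y] [CompleteSpace Y]
    (T : ℝ) (hT : 0 < T)
    (U : ℝ → ℝ → X →L[ℝ] X)
    (hUid : ∀ s ∈ Icc (0 : ℝ) T, U s s = ContinuousLinearMap.id ℝ X)
    (hUcomp : ∀ r s t : ℝ, 0 ≤ r → r ≤ s → s ≤ t → t ≤ T →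
      (U t s).comp (U s r) = U t r)
    (M ω : ℝ) (hM : 1 ≤ M)
    (hUexp : ∀ s t : ℝ, 0 ≤ s → s ≤ t → t ≤ T → ‖U t s‖ ≤ M * Real.exp (ω * (t - s)))
    (C : ℝ → X →L[ℝ] Y) (K : ℝ) (hC : ∀ t ∈ Icc (0 : ℝ) T, ‖C t‖ ≤ K)
    (hCmeas : ∀ x₀ : X, Measurable fun t : Icc (0 : ℝ) T => ‖C t.1 ((U t.1 0) x₀)‖)
    (P : ℝ → X →L[ℝ] X) (KP : ℝ) (hP : ∀ lam : ℝ, 0 < lam → ‖P lam‖ ≤ KP)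
    (d₀ d₁ γ₁ : ℝ) (hd₀ : 0 < d₀) (hd₁ : 0 < d₁) (hγ₁ : 0 < γ₁)
    (huncert : ∀ lam : ℝ, 0 < lam → ∀ t ∈ Icc (0 : ℝ) T, ∀ x : X,
      ‖P lam x‖ ≤ d₀ * Real.exp (d₁ * lam ^ γ₁) * ‖C t (P lam x)‖)
    (d₂ d₃ γ₂ γ₃ : ℝ) (hd₂ : 1 ≤ d₂) (hd₃ : 0 < d₃) (hγ₂ : 0 < γ₂) (hγ₃ : 0 < γ₃)
    (hγ : γ₁ < γ₂)
    (hdiss : ∀ lam : ℝ, 0 < lam → ∀ s t : ℝ, 0 ≤ s → s ≤ t → t ≤ T → ∀ x : X,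
      ‖U t s x - P lam (U t s x)‖ ≤
        d₂ * Real.exp (-(d₃ * lam ^ γ₂ * (t - s) ^ γ₃)) * ‖x‖)
    (E : Set ℝ) (hEmeas : MeasurableSet E) (hEsub : E ⊆ Icc 0 T) (hEpos : 0 < volume E) :
    ∃ Cobs : ℝ, 0 ≤ Cobs ∧ ∀ x₀ : X,
      ‖U T 0 x₀‖ ≤ Cobs * essSup (fun t => ‖C t (U t 0 x₀)‖) (volume.restrict E) := by
  have hK : 0 ≤ K := (norm_nonneg _).trans (hC T ⟨hT.le, le_rfl⟩)
  obtain ⟨M', hM', hU⟩ : ∃ M' : ℝ, 0 < M' ∧ ∀ s t : ℝ, 0 ≤ s → s ≤ t → t ≤ T →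
      ∀ x, ‖U t s x‖ ≤ M' * ‖x‖ := by
    refine ⟨M * Real.exp (|ω| * T), by positivity, fun s t hs hst ht x => ?_⟩
    refine (U t s).le_of_opNorm_le ((hUexp s t hs hst ht).trans ?_) x
    gcongr
    · exact le_abs_self ω
    · linarith
  have hcomp : ∀ s t : ℝ, 0 ≤ s → s ≤ t → t ≤ T → ∀ x, U t 0 x = U t s (U s 0 x) :=
    fun s t hs hst ht x => by rw [← hUcomp 0 s t le_rfl hs hst ht]; rfl
  have hinterp : ∀ lam : ℝ, 0 < lam → ∀ s t : ℝ, 0 ≤ s → s ≤ t → t ≤ T → ∀ x,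
      ‖U t 0 x‖ ≤ d₀ * Real.exp (d₁ * lam ^ γ₁) * ‖C t (U t 0 x)‖ +
        (1 + d₀ * K) * Real.exp (d₁ * lam ^ γ₁) *
          (d₂ * Real.exp (-(d₃ * lam ^ γ₂ * (t - s) ^ γ₃)) * ‖U s 0 x‖) := by
    intro lam hlam s t hs hst ht x
    have htI : t ∈ Icc (0 : ℝ) T := ⟨hs.trans hst, ht⟩
    have hd := hdiss lam hlam s t hs hst ht (U s 0 x)
    rw [← hcomp s t hs hst ht x] at hd
    set z := U t 0 x
    set R := d₂ * Real.exp (-(d₃ * lam ^ γ₂ * (t - s) ^ γ₃)) * ‖U s 0 x‖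
    set e := Real.exp (d₁ * lam ^ γ₁)
    have he : 1 ≤ e := Real.one_le_exp (by positivity)
    have hR : 0 ≤ R := (norm_nonneg _).trans hd
    have hCP : ‖C t (P lam z)‖ ≤ ‖C t z‖ + K * R := by
      have h1 : C t (P lam z) = C t z - C t (z - P lam z) := by simp
      rw [h1]
      refine (norm_sub_le _ _).trans ?_
      gcongr
      exact ((C t).le_of_opNorm_le (hC t htI) _).trans (by gcongr)
    have hz : ‖z‖ ≤ ‖P lam z‖ + R := by
      have h1 : z = P lam z + (z - P lam z) := by abel
      calc ‖z‖ = ‖P lam z + (z - P lam z)‖ := by rw [← h1]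
        _ ≤ _ := (norm_add_le _ _).trans (by gcongr)
    calc ‖z‖ ≤ d₀ * e * (‖C t z‖ + K * R) + 1 * R := by
          rw [one_mul]
          refine hz.trans ?_
          gcongr
          exact (huncert lam hlam t htI z).trans (by gcongr)
      _ ≤ d₀ * e * (‖C t z‖ + K * R) + e * R := by gcongr
      _ = _ := by ring
  obtain ⟨τ, hτE, r₀, hr₀, hdens⟩ := exists_density_point_right hEmeas hEpos
  have hτ0 : 0 ≤ τ := (hEsub hτE).1
  have hτT : τ + 3 / 4 * r₀ ≤ T := by
    obtain ⟨t, htE, ht⟩ := nonempty_of_measure_ne_zero (hdens r₀ hr₀ le_rfl).ne'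
    exact ht.1.trans (hEsub htE).2
  set ρ : ℕ → ℝ := fun m => 3 / 4 * r₀ * (1 / 2) ^ m with hρ
  have hρpos : ∀ m, 0 < ρ m := fun m => by positivity
  have hρle : ∀ m, ρ m ≤ 3 / 4 * r₀ := fun m =>
    mul_le_of_le_one_right (by positivity) (pow_le_one₀ (by norm_num) (by norm_num))
  have hρsucc : ∀ m, ρ (m + 1) = ρ m / 2 := fun m => by simp only [hρ, pow_succ]; ring
  set N := M' * (1 + d₀ * K) * d₂ with hNdef
  have hN : 0 < N := by positivity
  obtain ⟨lam, hlam, hlamN⟩ := exists_frequencies (ρ := 3 / 4 * r₀ / 4) (d := d₁) hN hd₃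
    (by positivity) hγ₁ hγ₃ hγ
  set e : ℕ → ℝ := fun m => Real.exp (d₁ * lam m ^ γ₁) with he
  have he1 : ∀ m, 1 ≤ e m := fun m =>
    Real.one_le_exp (mul_nonneg hd₁.le (Real.rpow_nonneg (hlam m).le _))
  refine ⟨M' * (e 0 * (2 * (M' * d₀))), by positivity, fun x => ?_⟩
  set S := essSup (fun t => ‖C t (U t 0 x)‖) (volume.restrict E) with hS
  have hae : ∀ᵐ t ∂volume.restrict E, ‖C t (U t 0 x)‖ ≤ S := by
    refine ae_le_essSup (Filter.isBoundedUnder_of_eventually_le (a := K * (M' * ‖x‖)) ?_)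
    filter_upwards [ae_restrict_mem hEmeas] with t ht
    have htI := hEsub ht
    exact ((C t).le_of_opNorm_le (hC t htI) _).trans
      (mul_le_mul_of_nonneg_left (hU 0 t le_rfl htI.1 htI.2 x) hK)
  have hpick : ∀ m, ∃ t, τ + 3 / 4 * ρ m ≤ t ∧ t ≤ τ + ρ m ∧ ‖C t (U t 0 x)‖ ≤ S := by
    intro m
    rw [ae_restrict_iff' hEmeas] at hae
    have hfreq := frequently_ae_mem_iff.2
      (hdens (ρ m) (hρpos m) ((hρle m).trans (by linarith))).ne'
    obtain ⟨t, ⟨htE, ht⟩, htS⟩ := (hfreq.and_eventually hae).exists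
    exact ⟨t, ht.1, ht.2, htS htE⟩
  have hmem : ∀ m, 0 ≤ τ + ρ m ∧ τ + ρ m ≤ T := fun m =>
    ⟨by linarith [hρpos m], by linarith [hρle m]⟩
  have hstep : ∀ m, ‖U (τ + ρ m) 0 x‖ / e m
      ≤ M' * d₀ * S + ‖U (τ + ρ (m + 1)) 0 x‖ / e (m + 1) / 2 := by
    intro m
    obtain ⟨t, ht1, ht2, htS⟩ := hpick m
    have hst : τ + ρ (m + 1) + ρ m / 4 ≤ t := by rw [hρsucc]; linarith
    have hst' : τ + ρ (m + 1) ≤ t := by linarith [hρpos m]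
    have ht0 : 0 ≤ t := (hmem (m + 1)).1.trans hst'
    have h1 : ‖U (τ + ρ m) 0 x‖ ≤ M' * ‖U t 0 x‖ := by
      rw [hcomp t _ ht0 ht2 (hmem m).2]
      exact hU t _ ht0 ht2 (hmem m).2 _
    have h2 := hinterp (lam m) (hlam m) _ t (hmem (m + 1)).1 hst' (ht2.trans (hmem m).2) x
    set F := ‖U (τ + ρ (m + 1)) 0 x‖
    set q := Real.exp (-(d₃ * lam m ^ γ₂ * (3 / 4 * r₀ / 4 * (1 / 2) ^ m) ^ γ₃)) with hq
    have hlamm := hlam m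
    have h3 : Real.exp (-(d₃ * lam m ^ γ₂ * (t - (τ + ρ (m + 1))) ^ γ₃)) ≤ q := by
      rw [hq]
      gcongr
      calc 3 / 4 * r₀ / 4 * (1 / 2) ^ m = ρ m / 4 := by simp only [hρ]; ring
        _ ≤ _ := by linarith
    have hem : 0 < e m := by linarith [he1 m]
    have hem' : 0 < e (m + 1) := by linarith [he1 (m + 1)]
    have hF : 0 ≤ F := norm_nonneg _
    have h4 : N * q ≤ 1 / 2 / e (m + 1) := (le_div_iff₀ hem').2 (hlamN m)
    rw [div_le_iff₀ hem]
    calc ‖U (τ + ρ m) 0 x‖ ≤ M' * ‖U t 0 x‖ := h1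
      _ ≤ M' * (d₀ * e m * S + (1 + d₀ * K) * e m * (d₂ * q * F)) := by
        gcongr
        exact h2.trans (by gcongr)
      _ = (M' * d₀ * S + N * q * F) * e m := by rw [hNdef]; ring
      _ ≤ (M' * d₀ * S + 1 / 2 / e (m + 1) * F) * e m := by gcongr
      _ = _ := by ring
  have hbdd : ∀ m, ‖U (τ + ρ m) 0 x‖ / e m ≤ M' * ‖x‖ := fun m =>
    (div_le_self (norm_nonneg _) (he1 m)).trans
      (hU 0 _ le_rfl (hmem m).1 (hmem m).2 x)
  have hfin := le_two_mul_of_le_add_half_succ hbdd hstep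
  rw [div_le_iff₀ (by linarith [he1 0])] at hfin
  calc ‖U T 0 x‖ = ‖U T (τ + ρ 0) (U (τ + ρ 0) 0 x)‖ := by
        rw [← hcomp _ T (hmem 0).1 (hmem 0).2 le_rfl]
    _ ≤ M' * ‖U (τ + ρ 0) 0 x‖ := hU _ T (hmem 0).1 (hmem 0).2 le_rfl _
    _ ≤ M' * (2 * (M' * d₀ * S) * e 0) := by gcongr
    _ = _ := by ring
end

section
/- Let X, Y be Banach spaces and T > 0, and suppose the family (U(t,s))_{0≤s≤t≤T}, the observation family (C(t))_{t∈[0,T]}, and the cutoff family (P_λ)_{λ>0} satisfy the abstract hypotheses (algebraic evolution-family property, exponential boundedness, boundedness of C, boundedness of (P_λ), the uncertainty principle and the dissipation estimate with exponents γ₁ < γ₂). Let θ ∈ (0,1). Then there exist constants C̃₁, C̃₂, C̃₃ ≥ 0 such that for all x₀ ∈ X and all 0 ≤ s < t ≤ T one has ‖U(t,0)x₀‖_X ≤ C̃₁ · exp( C̃₂ · (t−s)^{−γ₁γ₃/(γ₂−γ₁)} + C̃₃·(t−s) ) · ‖C(t)(U(t,0)x₀)‖_Y^{1−θ} · ‖U(s,0)x₀‖_X^{θ}.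 -/
open MeasureTheory Set

/-- A Young-type inequality comparing two powers of the spectral parameter `l`, with the optimal
dependence on the time step `τ`. -/
theorem mul_rpow_le_add_mul_rpow_mul_rpow {d e γ₁ γ₂ γ₃ τ l : ℝ} (hd : 0 < d) (he : 0 < e)
    (hγ₁ : 0 < γ₁) (hγ : γ₁ < γ₂) (hτ : 0 < τ) (hl : 0 < l) :
    d * l ^ γ₁ ≤ d * (d / e) ^ (γ₁ / (γ₂ - γ₁)) * τ ^ (-(γ₁ * γ₃ / (γ₂ - γ₁)))
      + e * (l ^ γ₂ * τ ^ γ₃) := by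
  have hg : 0 < γ₂ - γ₁ := sub_pos.2 hγ
  rcases le_total d (e * (l ^ (γ₂ - γ₁) * τ ^ γ₃)) with h | h
  · have h₁ : d * l ^ γ₁ ≤ e * (l ^ γ₂ * τ ^ γ₃) :=
      calc d * l ^ γ₁ ≤ e * (l ^ (γ₂ - γ₁) * τ ^ γ₃) * l ^ γ₁ := by gcongr
        _ = e * (l ^ γ₂ * τ ^ γ₃) := by
          have : l ^ γ₂ = l ^ (γ₂ - γ₁) * l ^ γ₁ := by
            rw [← Real.rpow_add hl, sub_add_cancel]
          rw [this]
          ring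
    have h₂ : 0 ≤ d * (d / e) ^ (γ₁ / (γ₂ - γ₁)) * τ ^ (-(γ₁ * γ₃ / (γ₂ - γ₁))) := by positivity
    linarith
  · have h₁ : l ^ (γ₂ - γ₁) ≤ d / e * τ ^ (-γ₃) := by
      rw [Real.rpow_neg hτ.le, ← div_eq_mul_inv, div_div, le_div_iff₀ (by positivity)]
      linarith
    have h₂ : l ^ γ₁ ≤ (d / e) ^ (γ₁ / (γ₂ - γ₁)) * τ ^ (-(γ₁ * γ₃ / (γ₂ - γ₁))) :=
      calc l ^ γ₁ = (l ^ (γ₂ - γ₁)) ^ (γ₁ / (γ₂ - γ₁)) := by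
            rw [← Real.rpow_mul hl.le, mul_div_cancel₀ _ hg.ne']
        _ ≤ (d / e * τ ^ (-γ₃)) ^ (γ₁ / (γ₂ - γ₁)) := by gcongr
        _ = _ := by
          rw [Real.mul_rpow (by positivity) (by positivity), ← Real.rpow_mul hτ.le]
          congr 2
          ring
    have h₃ : 0 ≤ e * (l ^ γ₂ * τ ^ γ₃) := by positivity
    have h₄ := mul_le_mul_of_nonneg_left h₂ hd.le
    linarith

/-- Optimising a family of spectral estimates over the spectral parameter yields an interpolation
inequality. -/
theorem le_mul_rpow_mul_rpow_of_forall_le {a b c A d e γ₁ γ₂ γ₃ τ θ : ℝ} (hc : 0 < c)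
    (hcb : c < b) (hA : 0 ≤ A) (hd : 0 < d) (he : 0 < e) (hγ₁ : 0 < γ₁) (hγ : γ₁ < γ₂)
    (hτ : 0 < τ) (hθ : 0 < θ)
    (h : ∀ l : ℝ, 0 < l →
      a ≤ A * Real.exp (d * l ^ γ₁) * (c + Real.exp (-(e * l ^ γ₂ * τ ^ γ₃)) * b)) :
    a ≤ 2 * A * Real.exp (d * (d / (θ * e)) ^ (γ₁ / (γ₂ - γ₁)) * τ ^ (-(γ₁ * γ₃ / (γ₂ - γ₁)))) *
      c ^ (1 - θ) * b ^ θ := by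
  have hb : 0 < b := hc.trans hcb
  have hL : 0 < Real.log (b / c) := Real.log_pos ((one_lt_div hc).2 hcb)
  have hγ₂ : 0 < γ₂ := hγ₁.trans hγ
  set l : ℝ := (Real.log (b / c) / (e * τ ^ γ₃)) ^ γ₂⁻¹ with hl_def
  have hl : 0 < l := by positivity
  have hpow : l ^ γ₂ = Real.log (b / c) / (e * τ ^ γ₃) :=
    Real.rpow_inv_rpow (by positivity) hγ₂.ne'
  have heq : e * l ^ γ₂ * τ ^ γ₃ = Real.log (b / c) := by
    rw [hpow]
    field_simp
  have hexp : Real.exp (-(e * l ^ γ₂ * τ ^ γ₃)) * b = c := by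
    rw [heq, Real.exp_neg, Real.exp_log (by positivity)]
    field_simp
  have hyoung := mul_rpow_le_add_mul_rpow_mul_rpow (γ₃ := γ₃) hd (mul_pos hθ he) hγ₁ hγ hτ hl
  have hlast : θ * e * (l ^ γ₂ * τ ^ γ₃) = Real.log (b / c) * θ := by
    rw [← heq]
    ring
  rw [hlast] at hyoung
  have hE := Real.exp_le_exp.2 hyoung
  rw [Real.exp_add, Real.exp_mul (Real.log _), Real.exp_log (by positivity),
    Real.div_rpow hb.le hc.le] at hE
  have hmain := h l hl
  rw [hexp] at hmain
  refine hmain.trans ?_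
  rw [Real.rpow_sub hc, Real.rpow_one]
  calc A * Real.exp (d * l ^ γ₁) * (c + c) = 2 * A * c * Real.exp (d * l ^ γ₁) := by ring
    _ ≤ 2 * A * c * _ := mul_le_mul_of_nonneg_left hE (by positivity)
    _ = _ := by ring

/-- Combination of an uncertainty principle and a dissipation estimate for one vector `u` and one
approximation `p` of it. -/
theorem norm_le_of_uncertainty_of_dissipation {X Y : Type*} [NormedAddCommGroup X]
    [NormedSpace ℝ X] [NormedAddCommGroup Y] [NormedSpace ℝ Y] (L : X →L[ℝ] Y) {u p : X}
    {K d₀ d₂ E F b : ℝ} (hL : ‖L‖ ≤ K) (hd₀ : 0 ≤ d₀) (hd₂ : 0 ≤ d₂) (hE : 1 ≤ E) (hF : 0 ≤ F)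
    (hb : 0 ≤ b) (hp : ‖p‖ ≤ d₀ * E * ‖L p‖) (hup : ‖u - p‖ ≤ d₂ * F * b) :
    ‖u‖ ≤ (d₀ + (d₀ * K + 1) * d₂) * E * (‖L u‖ + F * b) := by
  have hK : 0 ≤ K := (norm_nonneg L).trans hL
  have h₁ : ‖u‖ ≤ ‖p‖ + ‖u - p‖ := norm_le_norm_add_norm_sub' u p
  have h₂ : ‖L p‖ ≤ ‖L u‖ + K * (d₂ * F * b) :=
    calc ‖L p‖ = ‖L u - L (u - p)‖ := by rw [← map_sub, sub_sub_cancel]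
      _ ≤ ‖L u‖ + ‖L (u - p)‖ := norm_sub_le _ _
      _ ≤ ‖L u‖ + K * (d₂ * F * b) := by
        gcongr
        exact (L.le_of_opNorm_le hL _).trans (by gcongr)
  calc ‖u‖ ≤ d₀ * E * (‖L u‖ + K * (d₂ * F * b)) + 1 * (d₂ * F * b) := by
        rw [one_mul]
        exact h₁.trans (add_le_add (hp.trans (by gcongr)) hup)
    _ ≤ d₀ * E * (‖L u‖ + K * (d₂ * F * b)) + E * (d₂ * F * b) := by gcongr
    _ ≤ d₀ * E * (‖L u‖ + K * (d₂ * F * b)) + E * (d₂ * F * b) +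
          (E * (d₀ * K + 1) * d₂ * ‖L u‖ + E * d₀ * F * b) :=
        le_add_of_nonneg_right (by positivity)
    _ = _ := by ring

/-- **Interpolation estimate for evolution families.** Under the abstract hypotheses,
for each `θ ∈ (0,1)` there are `C̃₁, C̃₂, C̃₃ ≥ 0` such that for all `x₀` and `0 ≤ s < t ≤ T`:
`‖U(t,0)x₀‖ ≤ C̃₁ exp(C̃₂ (t-s)^{-γ₁γ₃/(γ₂-γ₁)} + C̃₃(t-s)) ‖C(t)U(t,0)x₀‖^{1-θ} ‖U(s,0)x₀‖^θ`. -/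
theorem statement2
    {X Y : Type*} [NormedAddCommGroup X] [NormedSpace ℝ X] [CompleteSpace X]
    [NormedAddCommGroup Y] [NormedSpace ℝ Y] [CompleteSpace Y]
    (T : ℝ) (hT : 0 < T)
    (U : ℝ → ℝ → X →L[ℝ] X)
    (hUid : ∀ s ∈ Icc (0 : ℝ) T, U s s = ContinuousLinearMap.id ℝ X)
    (hUcomp : ∀ r s t : ℝ, 0 ≤ r → r ≤ s → s ≤ t → t ≤ T →
      (U t s).comp (U s r) = U t r)
    (M ω : ℝ) (hM : 1 ≤ M)
    (hUexp : ∀ s t : ℝ, 0 ≤ s → s ≤ t → t ≤ T → ‖U t s‖ ≤ M * Real.exp (ω * (t - s)))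
    (C : ℝ → X →L[ℝ] Y) (K : ℝ) (hC : ∀ t ∈ Icc (0 : ℝ) T, ‖C t‖ ≤ K)
    (P : ℝ → X →L[ℝ] X) (KP : ℝ) (hP : ∀ lam : ℝ, 0 < lam → ‖P lam‖ ≤ KP)
    (d₀ d₁ γ₁ : ℝ) (hd₀ : 0 < d₀) (hd₁ : 0 < d₁) (hγ₁ : 0 < γ₁)
    (huncert : ∀ lam : ℝ, 0 < lam → ∀ t ∈ Icc (0 : ℝ) T, ∀ x : X,
      ‖P lam x‖ ≤ d₀ * Real.exp (d₁ * lam ^ γ₁) * ‖C t (P lam x)‖)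
    (d₂ d₃ γ₂ γ₃ : ℝ) (hd₂ : 1 ≤ d₂) (hd₃ : 0 < d₃) (hγ₂ : 0 < γ₂) (hγ₃ : 0 < γ₃)
    (hγ : γ₁ < γ₂)
    (hdiss : ∀ lam : ℝ, 0 < lam → ∀ s t : ℝ, 0 ≤ s → s ≤ t → t ≤ T → ∀ x : X,
      ‖U t s x - P lam (U t s x)‖ ≤
        d₂ * Real.exp (-(d₃ * lam ^ γ₂ * (t - s) ^ γ₃)) * ‖x‖)
    (θ : ℝ) (hθ₀ : 0 < θ) (hθ₁ : θ < 1) :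
    ∃ C₁ C₂ C₃ : ℝ, 0 ≤ C₁ ∧ 0 ≤ C₂ ∧ 0 ≤ C₃ ∧ ∀ x₀ : X, ∀ s t : ℝ,
      0 ≤ s → s < t → t ≤ T →
      ‖U t 0 x₀‖ ≤ C₁ * Real.exp (C₂ * (t - s) ^ (-(γ₁ * γ₃ / (γ₂ - γ₁))) + C₃ * (t - s)) *
        ‖C t (U t 0 x₀)‖ ^ (1 - θ) * ‖U s 0 x₀‖ ^ θ := by
  have hK : 0 ≤ K := (norm_nonneg _).trans (hC 0 ⟨le_rfl, hT.le⟩)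
  set A : ℝ := d₀ + (d₀ * K + 1) * d₂
  have hA : 0 ≤ A := by positivity
  refine ⟨2 * A + M, d₁ * (d₁ / (θ * d₃)) ^ (γ₁ / (γ₂ - γ₁)), |ω|, by positivity, by positivity,
    abs_nonneg ω, fun x₀ s t hs hst htT ↦ ?_⟩
  have ht : t ∈ Icc (0 : ℝ) T := ⟨hs.trans hst.le, htT⟩
  have hτ : 0 < t - s := sub_pos.2 hst
  have hU : U t 0 x₀ = U t s (U s 0 x₀) := by
    rw [← hUcomp 0 s t le_rfl hs hst.le htT, ContinuousLinearMap.comp_apply]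
  have hspec : ∀ l : ℝ, 0 < l → ‖U t 0 x₀‖ ≤ A * Real.exp (d₁ * l ^ γ₁) *
      (‖C t (U t 0 x₀)‖ + Real.exp (-(d₃ * l ^ γ₂ * (t - s) ^ γ₃)) * ‖U s 0 x₀‖) := by
    intro l hl
    refine norm_le_of_uncertainty_of_dissipation (C t) (hC t ht) hd₀.le (by linarith)
      (Real.one_le_exp (by positivity)) (Real.exp_nonneg _) (norm_nonneg _)
      (huncert l hl t ht (U t 0 x₀)) ?_
    rw [hU]
    exact hdiss l hl s t hs hst.le htT _
  set R : ℝ := (t - s) ^ (-(γ₁ * γ₃ / (γ₂ - γ₁)))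
  set D : ℝ := d₁ * (d₁ / (θ * d₃)) ^ (γ₁ / (γ₂ - γ₁))
  have hDR : 0 ≤ D * R := by positivity
  have hωτ : 0 ≤ |ω| * (t - s) := by positivity
  have hbound : ∀ c : ℝ, ‖C t (U t 0 x₀)‖ < c →
      ‖U t 0 x₀‖ ≤ (2 * A + M) * Real.exp (D * R + |ω| * (t - s)) * c ^ (1 - θ) *
        ‖U s 0 x₀‖ ^ θ := by
    intro c hc
    have hc₀ : 0 < c := (norm_nonneg _).trans_lt hc
    rcases lt_or_ge c ‖U s 0 x₀‖ with hcb | hbc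
    · refine (le_mul_rpow_mul_rpow_of_forall_le (γ₃ := γ₃) hc₀ hcb hA hd₁ hd₃ hγ₁ hγ hτ hθ₀
        fun l hl ↦ (hspec l hl).trans ?_).trans ?_
      · gcongr
      · change 2 * A * Real.exp (D * R) * c ^ (1 - θ) * ‖U s 0 x₀‖ ^ θ ≤ _
        gcongr <;> linarith
    · calc ‖U t 0 x₀‖ ≤ M * Real.exp (ω * (t - s)) * ‖U s 0 x₀‖ := by
            rw [hU]
            exact (U t s).le_of_opNorm_le (hUexp s t hs hst.le htT) _
        _ = M * Real.exp (ω * (t - s)) * ‖U s 0 x₀‖ ^ (1 - θ) * ‖U s 0 x₀‖ ^ θ := by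
            rw [mul_assoc _ (_ ^ _) (_ ^ _), ← Real.rpow_add' (norm_nonneg _) (by simp),
              sub_add_cancel, Real.rpow_one]
        _ ≤ _ := by
            have : ω * (t - s) ≤ |ω| * (t - s) := by gcongr; exact le_abs_self ω
            gcongr <;> linarith
  have hcont : Continuous fun c : ℝ ↦ (2 * A + M) * Real.exp (D * R + |ω| * (t - s)) *
      c ^ (1 - θ) * ‖U s 0 x₀‖ ^ θ :=
    (continuous_const.mul (Real.continuous_rpow_const (by linarith))).mul continuous_const
  exact ge_of_tendsto (hcont.continuousWithinAt (s := Ioi ‖C t (U t 0 x₀)‖))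
    (Filter.eventually_of_mem self_mem_nhdsWithin hbound)
end

section
/- Let F₁, F₂, G, D, C ≥ 0 be real numbers and θ ∈ (0,1). Assume that for all ε ∈ (0,1] one has F₂ ≤ D·F₁ and F₂ ≤ C·( ε^{−θ/(1−θ)}·G + ε·F₁ ). Then F₂ ≤ max{ C / (θ^θ · (1−θ)^{1−θ}), D · (θ/(1−θ))^{1−θ} } · F₁^θ · G^{1−θ}. -/
/-- **Interpolation lemma.** If `F₂ ≤ D·F₁` and, for all `ε ∈ (0,1]`,
`F₂ ≤ C·(ε^{-θ/(1-θ)}·G + ε·F₁)`, then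
`F₂ ≤ max{C/(θ^θ(1-θ)^{1-θ}), D·(θ/(1-θ))^{1-θ}}·F₁^θ·G^{1-θ}`. -/
theorem statement3 (F₁ F₂ G D C : ℝ) (hF₁ : 0 ≤ F₁) (hF₂ : 0 ≤ F₂) (hG : 0 ≤ G)
    (hD : 0 ≤ D) (hC : 0 ≤ C) (θ : ℝ) (hθ₀ : 0 < θ) (hθ₁ : θ < 1)
    (h : ∀ ε : ℝ, 0 < ε → ε ≤ 1 →
      F₂ ≤ D * F₁ ∧ F₂ ≤ C * (ε ^ (-(θ / (1 - θ))) * G + ε * F₁)) :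
    F₂ ≤ max (C / (θ ^ θ * (1 - θ) ^ (1 - θ))) (D * (θ / (1 - θ)) ^ (1 - θ)) *
      F₁ ^ θ * G ^ (1 - θ) := by
  have hθ : 0 < 1 - θ := sub_pos.2 hθ₁
  have ha : 0 < θ / (1 - θ) := div_pos hθ₀ hθ
  obtain hle | hlt := le_or_gt F₁ (θ / (1 - θ) * G)
  · calc F₂ ≤ D * F₁ := (h 1 one_pos le_rfl).1
      _ = D * (F₁ ^ (1 - θ) * F₁ ^ θ) := by
        rw [← Real.rpow_add' hF₁ (by norm_num), sub_add_cancel, Real.rpow_one]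
      _ ≤ D * ((θ / (1 - θ) * G) ^ (1 - θ) * F₁ ^ θ) := by gcongr
      _ = D * (θ / (1 - θ)) ^ (1 - θ) * F₁ ^ θ * G ^ (1 - θ) := by
        rw [Real.mul_rpow ha.le hG]; ring
      _ ≤ _ := by gcongr; exact le_max_right _ _
  have hF₁' : 0 < F₁ := (mul_nonneg ha.le hG).trans_lt hlt
  obtain rfl | hG' := hG.eq_or_lt
  · rw [Real.zero_rpow hθ.ne', mul_zero]
    by_contra! hpos
    have hCF : 0 ≤ C * F₁ := mul_nonneg hC hF₁
    have hsum : 0 < F₂ + C * F₁ := by positivity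
    have hε := (h (F₂ / (F₂ + C * F₁)) (by positivity)
      ((div_le_one hsum).2 (by linarith))).2
    have heq : C * ((F₂ / (F₂ + C * F₁)) ^ (-(θ / (1 - θ))) * 0 + F₂ / (F₂ + C * F₁) * F₁) =
        F₂ * (C * F₁) / (F₂ + C * F₁) := by ring
    rw [heq, le_div_iff₀ hsum] at hε
    nlinarith
  · obtain ⟨t, ht⟩ : ∃ t, t = θ / (1 - θ) * G / F₁ := ⟨_, rfl⟩
    have ht₀ : 0 < t := by rw [ht]; positivity
    have ht₁ : t ≤ 1 := by rw [ht]; exact (div_le_one hF₁').2 hlt.le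
    have hGt : G = t * F₁ * (1 - θ) / θ := by rw [ht]; field_simp
    have hpow : (t ^ (1 - θ)) ^ (-(θ / (1 - θ))) * t = t ^ (1 - θ) := by
      rw [← Real.rpow_mul ht₀.le, ← Real.rpow_add_one ht₀.ne']
      congr 1
      field_simp
      ring
    have hsplit : ∀ x : ℝ, 0 < x → x ^ θ * x ^ (1 - θ) = x := fun x hx => by
      rw [← Real.rpow_add hx, add_sub_cancel, Real.rpow_one]
    calc F₂ ≤ C * ((t ^ (1 - θ)) ^ (-(θ / (1 - θ))) * G + t ^ (1 - θ) * F₁) :=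
          (h _ (by positivity) (Real.rpow_le_one ht₀.le ht₁ hθ.le)).2
      _ = C * (((t ^ (1 - θ)) ^ (-(θ / (1 - θ))) * t) * (F₁ * (1 - θ) / θ)
            + t ^ (1 - θ) * F₁) := by
        rw [hGt]; ring
      _ = C * (t ^ (1 - θ) * F₁ / θ) := by rw [hpow]; field_simp; ring
      _ = C * (t ^ (1 - θ) * (F₁ ^ θ * F₁ ^ (1 - θ)) / (θ ^ θ * θ ^ (1 - θ))) := by
        rw [hsplit F₁ hF₁', hsplit θ hθ₀]
      _ = C / (θ ^ θ * (1 - θ) ^ (1 - θ)) * F₁ ^ θ * G ^ (1 - θ) := by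
        rw [hGt, Real.div_rpow (by positivity) hθ₀.le, Real.mul_rpow (by positivity) hθ.le,
          Real.mul_rpow ht₀.le hF₁]
        field_simp
      _ ≤ _ := by gcongr; exact le_max_left _ _
end

section
/- Let d ≥ 1 and T > 0. For 0 ≤ s ≤ T and ξ, η ∈ ℝ^d one has 2s·|η|² + 2s²·(η·ξ) + (2/3)·s³·|ξ|² ≥ ((4 − √13)/3) · min{T^{−2}, 1} · s³ · ( |ξ|² + |η|² ). -/
open scoped RealInnerProductSpace

/-- The smallest eigenvalue of the matrix `!![2, 1; 1, 2/3]` is `(4 - √13) / 3`. -/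
theorem eigenvalue_mul_le_quadraticForm {E : Type*} [NormedAddCommGroup E]
    [InnerProductSpace ℝ E] (v w : E) :
    (4 - Real.sqrt 13) / 3 * (‖v‖ ^ 2 + ‖w‖ ^ 2) ≤
      2 * ‖w‖ ^ 2 + 2 * ⟪w, v⟫ + 2 / 3 * ‖v‖ ^ 2 := by
  have hr : Real.sqrt 13 ^ 2 = 13 := Real.sq_sqrt (by norm_num)
  have hr2 : 2 ≤ Real.sqrt 13 := Real.le_sqrt_of_sq_le (by norm_num)
  set r := Real.sqrt 13
  have h : 0 ≤ (r - 2) / 3 * ‖((2 + r) / 3) • w + v‖ ^ 2 :=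
    mul_nonneg (by linarith) (sq_nonneg _)
  rw [norm_add_sq_real, norm_smul, mul_pow, Real.norm_eq_abs, sq_abs, real_inner_smul_left] at h
  linear_combination h + ((2 + r) / 27 * ‖w‖ ^ 2 + 2 / 9 * ⟪w, v⟫) * hr

/-- The quadratic form arising from the Kolmogorov equation satisfies the coercivity bound
`2s|η|² + 2s²(η·ξ) + (2/3)s³|ξ|² ≥ ((4-√13)/3)·min{T⁻²,1}·s³·(|ξ|²+|η|²)`. -/
theorem statement17 (d : ℕ) (hd : 1 ≤ d) (T : ℝ) (hT : 0 < T)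
    (s : ℝ) (hs0 : 0 ≤ s) (hsT : s ≤ T)
    (ξ η : EuclideanSpace ℝ (Fin d)) :
    (4 - Real.sqrt 13) / 3 * min (T ^ 2)⁻¹ 1 * s ^ 3 * (‖ξ‖ ^ 2 + ‖η‖ ^ 2) ≤
      2 * s * ‖η‖ ^ 2 + 2 * s ^ 2 * ⟪η, ξ⟫ + 2 / 3 * s ^ 3 * ‖ξ‖ ^ 2 := by
  have hc : 0 ≤ (4 - Real.sqrt 13) / 3 := by
    have : Real.sqrt 13 ≤ 4 := Real.sqrt_le_iff.mpr (by norm_num)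
    linarith
  have hm1 : min (T ^ 2)⁻¹ 1 ≤ 1 := min_le_right _ _
  have hms : min (T ^ 2)⁻¹ 1 * s ^ 2 ≤ 1 := calc
    min (T ^ 2)⁻¹ 1 * s ^ 2 ≤ (T ^ 2)⁻¹ * T ^ 2 := by
      gcongr
      exact min_le_left _ _
    _ = 1 := inv_mul_cancel₀ (by positivity)
  have key := mul_le_mul_of_nonneg_left (eigenvalue_mul_le_quadraticForm (s • ξ) η) hs0
  rw [norm_smul, mul_pow, Real.norm_eq_abs, sq_abs, real_inner_smul_right] at key
  set m := min (T ^ 2)⁻¹ 1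
  calc (4 - Real.sqrt 13) / 3 * m * s ^ 3 * (‖ξ‖ ^ 2 + ‖η‖ ^ 2)
      = s * ((4 - Real.sqrt 13) / 3 * (m * (s ^ 2 * ‖ξ‖ ^ 2) + m * s ^ 2 * ‖η‖ ^ 2)) := by ring
    _ ≤ s * ((4 - Real.sqrt 13) / 3 * (1 * (s ^ 2 * ‖ξ‖ ^ 2) + 1 * ‖η‖ ^ 2)) := by gcongr
    _ ≤ 2 * s * ‖η‖ ^ 2 + 2 * s ^ 2 * ⟪η, ξ⟫ + 2 / 3 * s ^ 3 * ‖ξ‖ ^ 2 := by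
      linear_combination key
end
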